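/- Let m ∈ ℕ and let ω ∈ L²(−1,1) be m times continuously differentiable on (−1,1) with ∫_{−1}^{1} |ω^{(m)}(ξ)|² (1−ξ²)^m dξ < ∞. Then for every integer p ≥ m, the truncated Legendre expansion Π_p ω satisfies ‖ω − Π_p ω‖²_{L²(−1,1)} ≤ ((p−m+1)! / (p+m+1)!) · ∫_{−1}^{1} |ω^{(m)}(ξ)|² (1−ξ²)^m dξ. In particular there is a constant C depending only on m with ‖ω − Π_p ω‖_{L²(−1,1)} ≤ C p^{−m} (∫_{−1}^{1} |ω^{(m)}(ξ)|² (1−ξ²)^m dξ)^{1/2}. -/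

import Mathlib

open MeasureTheory Set

/-- The Legendre polynomial of degree `n` via Rodrigues' formula. -/
noncomputable def legendre (n : ℕ) (x : ℝ) : ℝ :=
  (1 / ((2 : ℝ) ^ n * (Nat.factorial n : ℝ))) *
    iteratedDeriv n (fun y : ℝ => (y ^ 2 - 1) ^ n) x

/-- The `n`-th Legendre coefficient of `f`. -/
noncomputable def legCoeff (f : ℝ → ℝ) (n : ℕ) : ℝ :=
  ((2 * (n : ℝ) + 1) / 2) * ∫ x in (-1 : ℝ)..1, f x * legendre n x

/-- The truncated Legendre expansion `Π_p f`. -/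
noncomputable def legProj (p : ℕ) (f : ℝ → ℝ) (x : ℝ) : ℝ :=
  ∑ n ∈ Finset.range (p + 1), legCoeff f n * legendre n x

namespace LegendreExpansion

open Polynomial

/-- `X ^ 2 - 1`, whose powers enter Rodrigues' formula. -/
noncomputable def quad : ℝ[X] := X ^ 2 - 1

/-- The unnormalised Legendre polynomial `dⁿ/dXⁿ (X² - 1)ⁿ`. -/
noncomputable def rodrigues (n : ℕ) : ℝ[X] := derivative^[n] (quad ^ n)

/-- The Legendre polynomial as an element of `ℝ[X]`. -/
noncomputable def leg (n : ℕ) : ℝ[X] := C (1 / ((2 : ℝ) ^ n * (n.factorial : ℝ))) * rodrigues n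

/-- The factor `(n + m)! / (n - m)!`, written as a product. -/
noncomputable def eigen (n m : ℕ) : ℝ :=
  ∏ k ∈ Finset.range m, (((n : ℝ) - k) * ((n : ℝ) + k + 1))

lemma iterate_deriv_eval (f : ℝ[X]) (n : ℕ) :
    deriv^[n] (fun x => f.eval x) = fun x => (derivative^[n] f).eval x := by
  induction n generalizing f with
  | zero => rfl
  | succ n ih =>
    have h : deriv (fun x => f.eval x) = fun x => (derivative f).eval x := by
      ext x
      exact f.deriv
    rw [Function.iterate_succ_apply, h, ih, Function.iterate_succ_apply]

lemma legendre_eq_eval (n : ℕ) (x : ℝ) : legendre n x = (leg n).eval x := by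
  have h : (fun y : ℝ => (y ^ 2 - 1) ^ n) = fun y => (quad ^ n).eval y := by
    ext y
    simp [quad]
  rw [legendre, leg, eval_mul, eval_C, iteratedDeriv_eq_iterate, h, iterate_deriv_eval, rodrigues]

lemma derivative_quad : derivative quad = 2 * X := by
  simp only [quad, derivative_sub, derivative_X_sq, derivative_one, sub_zero]
  rw [map_ofNat]

lemma quad_mul_derivative_pow (n : ℕ) :
    quad * derivative (quad ^ n) = C (2 * (n : ℝ)) * X * quad ^ n := by
  rcases n with _ | n
  · simp
  · rw [derivative_pow_succ, derivative_quad]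
    simp only [map_mul, map_add, map_natCast, map_one, map_ofNat, Nat.cast_add, Nat.cast_one]
    ring

lemma quad_mul_iterate_derivative (n j : ℕ) :
    quad * derivative^[j + 2] (quad ^ n) =
      C (2 * (n : ℝ) - 2 * (j + 1)) * X * derivative^[j + 1] (quad ^ n) +
        C (((j : ℝ) + 1) * (2 * n - j)) * derivative^[j] (quad ^ n) := by
  induction j with
  | zero =>
    have h := congrArg derivative (quad_mul_derivative_pow n)
    simp only [derivative_mul, derivative_quad, derivative_C, derivative_X] at h
    simp only [Function.iterate_succ_apply', Function.iterate_zero_apply, zero_add, map_mul, map_sub,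
      map_natCast, map_one, map_ofNat, Nat.cast_zero, map_zero] at h ⊢
    linear_combination h
  | succ j ih =>
    have h := congrArg derivative ih
    simp only [derivative_add, derivative_mul, derivative_quad, derivative_C, derivative_X] at h
    simp only [Function.iterate_succ_apply', map_mul, map_sub,
      map_add, map_natCast, map_one, map_ofNat, Nat.cast_add, Nat.cast_one] at h ⊢
    linear_combination h

lemma derivative_quad_pow_mul (n k : ℕ) :
    derivative (quad ^ (k + 1) * derivative^[k + 1] (rodrigues n)) =
      C (((n : ℝ) - k) * ((n : ℝ) + k + 1)) * (quad ^ k * derivative^[k] (rodrigues n)) := by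
  have h := quad_mul_iterate_derivative n (k + n)
  have e (i : ℕ) : derivative^[k + i] (rodrigues n) = derivative^[k + n + i] (quad ^ n) := by
    rw [rodrigues, ← Function.iterate_add_apply, add_right_comm]
  rw [derivative_mul, derivative_pow_succ, derivative_quad,
    ← Function.iterate_succ_apply' derivative (k + 1), Nat.succ_eq_add_one,
    add_assoc k 1 1, e 1, e (1 + 1), show k = k + 0 from rfl, e 0]
  simp only [map_mul, map_sub, map_add, map_natCast, map_one, map_ofNat, Nat.cast_add,
    add_zero] at h ⊢
  linear_combination quad ^ k * h

lemma iterate_derivative_quad_pow_mul (n m : ℕ) :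
    derivative^[m] (quad ^ m * derivative^[m] (rodrigues n)) = C (eigen n m) * rodrigues n := by
  induction m with
  | zero => simp [eigen]
  | succ m ih =>
    rw [Function.iterate_succ_apply, derivative_quad_pow_mul, iterate_derivative_C_mul, ih, eigen,
      eigen, Finset.prod_range_succ, ← mul_assoc, ← C_mul, mul_comm (_ * _) (Finset.prod _ _)]

lemma iterate_derivative_leg (n m : ℕ) :
    derivative^[m] (quad ^ m * derivative^[m] (leg n)) = C (eigen n m) * leg n := by
  rw [leg, iterate_derivative_C_mul, mul_left_comm, iterate_derivative_C_mul,
    iterate_derivative_quad_pow_mul, mul_left_comm]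

lemma eval_iterate_derivative_quad_pow_mul (A : ℝ[X]) {m j : ℕ} (h : j < m) {x : ℝ}
    (hx : x ^ 2 = 1) : (derivative^[j] (quad ^ m * A)).eval x = 0 := by
  obtain ⟨B, hB⟩ := pow_sub_dvd_iterate_derivative_of_pow_dvd j (Dvd.intro A rfl : quad ^ m ∣ _)
  rw [hB, eval_mul, eval_pow]
  have : quad.eval x = 0 := by simp [quad, hx]
  rw [this, zero_pow (by omega), zero_mul]

lemma integral_iterate_by_parts (m : ℕ) (B : ℝ[X])
    (hB : ∀ j < m, ∀ x : ℝ, x ^ 2 = 1 → (derivative^[j] B).eval x = 0) (F : ℕ → ℝ → ℝ)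
    (hF : ∀ k < m, ∀ x ∈ Icc (-1 : ℝ) 1, HasDerivAt (F k) (F (k + 1) x) x)
    (hc : ContinuousOn (F m) (Icc (-1) 1)) :
    ∫ x in (-1 : ℝ)..1, F m x * B.eval x =
      (-1) ^ m * ∫ x in (-1 : ℝ)..1, F 0 x * (derivative^[m] B).eval x := by
  induction m generalizing F with
  | zero => simp
  | succ m ih =>
    have hI : uIcc (-1 : ℝ) 1 = Icc (-1) 1 := uIcc_of_le (by norm_num)
    have hc1 : ContinuousOn (F 1) (Icc (-1) 1) := by
      rcases m with _ | m
      · exact hc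
      · exact fun x hx => (hF 1 (by omega) x hx).continuousAt.continuousWithinAt
    rw [ih (fun j hj => hB j (by omega)) (fun k => F (k + 1))
      (fun k hk => hF (k + 1) (by omega)) hc]
    have key := intervalIntegral.integral_mul_deriv_eq_deriv_mul (a := (-1 : ℝ)) (b := 1)
      (u := fun x => (derivative^[m] B).eval x) (v := F 0)
      (u' := fun x => (derivative^[m + 1] B).eval x) (v' := F 1)
      (fun x _ => by
        rw [Function.iterate_succ_apply']
        exact (derivative^[m] B).hasDerivAt x)
      (fun x hx => hF 0 (by omega) x (hI ▸ hx))
      ((derivative^[m + 1] B).continuous.intervalIntegrable _ _)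
      (ContinuousOn.intervalIntegrable (hI ▸ hc1))
    rw [hB m (by omega) 1 (by norm_num), hB m (by omega) (-1) (by norm_num)] at key
    simp only [mul_comm (F _ _), zero_add]
    rw [key]
    ring

lemma integral_mul_rodrigues (f : ℝ[X]) (n : ℕ) :
    ∫ x in (-1 : ℝ)..1, f.eval x * (rodrigues n).eval x =
      (-1) ^ n * ∫ x in (-1 : ℝ)..1, (derivative^[n] f).eval x * (quad ^ n).eval x := by
  have h := integral_iterate_by_parts n (quad ^ n)
    (fun j hj x hx => by simpa using eval_iterate_derivative_quad_pow_mul 1 hj hx)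
    (fun k x => (derivative^[k] f).eval x)
    (fun k _ x _ => by
      rw [Function.iterate_succ_apply']
      exact (derivative^[k] f).hasDerivAt x)
    (derivative^[n] f).continuous.continuousOn
  rw [h, ← mul_assoc, ← mul_pow]
  simp [rodrigues]

lemma natDegree_quad : quad.natDegree = 2 := by
  rw [quad, ← C_1]
  exact natDegree_X_pow_sub_C

lemma monic_quad : quad.Monic := by
  rw [quad, ← C_1]
  exact monic_X_pow_sub_C 1 (by norm_num)

lemma natDegree_quad_pow (n : ℕ) : (quad ^ n).natDegree = 2 * n := by
  rw [natDegree_pow, natDegree_quad, mul_comm]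

lemma coeff_rodrigues (n : ℕ) : (rodrigues n).coeff n = ((2 * n).descFactorial n : ℝ) := by
  have h : (quad ^ n).coeff (n + n) = 1 := by
    rw [← two_mul, ← natDegree_quad_pow]
    exact monic_quad.pow n
  rw [rodrigues, coeff_iterate_derivative, h, two_mul]
  simp

lemma natDegree_rodrigues_le (n : ℕ) : (rodrigues n).natDegree ≤ n := by
  refine (natDegree_iterate_derivative _ _).trans ?_
  rw [natDegree_quad_pow]
  omega

lemma degree_leg (n : ℕ) : (leg n).degree = n := by
  have h : (rodrigues n).coeff n ≠ 0 := by
    rw [coeff_rodrigues]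
    exact_mod_cast (Nat.descFactorial_pos.2 (by omega)).ne'
  rw [leg, degree_C_mul (by positivity)]
  exact degree_eq_of_le_of_coeff_ne_zero
    (natDegree_le_iff_degree_le.1 (natDegree_rodrigues_le n)) h

lemma iterate_derivative_rodrigues (n : ℕ) :
    derivative^[n] (rodrigues n) = C ((2 * n).factorial : ℝ) := by
  have h : (derivative^[n] (rodrigues n)).natDegree = 0 := by
    have := (natDegree_iterate_derivative (rodrigues n) n).trans
      (Nat.sub_le_sub_right (natDegree_rodrigues_le n) n)
    omega
  rw [eq_C_of_natDegree_eq_zero h, coeff_iterate_derivative, zero_add, coeff_rodrigues,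
    Nat.descFactorial_self, nsmul_eq_mul, ← Nat.cast_mul,
    show n.factorial = (2 * n - n).factorial by congr 1; omega,
    Nat.factorial_mul_descFactorial (by omega)]

lemma integral_one_sub_sq_pow (n : ℕ) :
    ∫ x in (-1 : ℝ)..1, (1 - x ^ 2) ^ n =
      2 ^ (2 * n + 1) * (n.factorial : ℝ) ^ 2 / ((2 * n + 1).factorial : ℝ) := by
  induction n with
  | zero => norm_num
  | succ n ih =>
    have h : ∫ x in (-1 : ℝ)..1,
        ((2 * (n : ℝ) + 3) * (1 - x ^ 2) ^ (n + 1) - (2 * n + 2) * (1 - x ^ 2) ^ n) = 0 := by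
      have := intervalIntegral.integral_eq_sub_of_hasDerivAt (a := (-1 : ℝ)) (b := 1)
        (f := fun x => x * (1 - x ^ 2) ^ (n + 1))
        (f' := fun x => (2 * (n : ℝ) + 3) * (1 - x ^ 2) ^ (n + 1) - (2 * n + 2) * (1 - x ^ 2) ^ n)
        (fun x _ => by
          have := (hasDerivAt_id x).mul ((((hasDerivAt_id x).pow 2).const_sub 1).pow (n + 1))
          refine (this.congr_deriv ?_)
          simp
          ring)
        (Continuous.intervalIntegrable (by fun_prop) _ _)
      rw [this]
      simp
    rw [intervalIntegral.integral_sub (Continuous.intervalIntegrable (by fun_prop) _ _)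
      (Continuous.intervalIntegrable (by fun_prop) _ _), intervalIntegral.integral_const_mul,
      intervalIntegral.integral_const_mul, ih] at h
    have h3 : (2 * (n : ℝ) + 3) ≠ 0 := by positivity
    rw [show 2 * (n + 1) + 1 = (2 * n + 1) + 1 + 1 by ring, Nat.factorial_succ (2 * n + 1 + 1),
      Nat.factorial_succ (2 * n + 1), Nat.factorial_succ n]
    apply mul_left_cancel₀ h3
    rw [sub_eq_zero.1 h]
    push_cast
    field_simp
    ring

lemma integral_leg_mul_leg_of_lt {k n : ℕ} (h : k < n) :
    ∫ x in (-1 : ℝ)..1, (leg k).eval x * (leg n).eval x = 0 := by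
  have h0 : derivative^[n] (leg k) = 0 :=
    iterate_derivative_eq_zero (by rwa [natDegree_eq_of_degree_eq_some (degree_leg k)])
  simp only [leg, eval_mul (p := C _) (q := rodrigues n), eval_C, mul_left_comm _ (1 / _ : ℝ)]
  rw [intervalIntegral.integral_const_mul, ← leg, integral_mul_rodrigues, h0]
  simp

lemma integral_leg_mul_leg_self (n : ℕ) :
    ∫ x in (-1 : ℝ)..1, (leg n).eval x * (leg n).eval x = 2 / (2 * n + 1) := by
  have e : ∀ x : ℝ, (leg n).eval x * (leg n).eval x =
      (1 / ((2 : ℝ) ^ n * (n.factorial : ℝ))) ^ 2 *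
        ((rodrigues n).eval x * (rodrigues n).eval x) := fun x => by
    simp only [leg, eval_mul, eval_C]
    ring
  have e' : ∀ x : ℝ, (derivative^[n] (rodrigues n)).eval x * (quad ^ n).eval x =
      (((2 * n).factorial : ℝ) * (-1) ^ n) * (1 - x ^ 2) ^ n := fun x => by
    rw [iterate_derivative_rodrigues, mul_assoc, ← mul_pow]
    simp [quad]
  simp only [e]
  rw [intervalIntegral.integral_const_mul, integral_mul_rodrigues]
  simp only [e']
  rw [intervalIntegral.integral_const_mul, integral_one_sub_sq_pow, Nat.factorial_succ (2 * n)]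
  have h1 : ((-1 : ℝ) ^ n) * (-1) ^ n = 1 := by rw [← mul_pow]; simp
  push_cast
  field_simp
  linear_combination (2 * 2 ^ (2 * n)) * h1

lemma integral_leg_mul_leg (k n : ℕ) :
    ∫ x in (-1 : ℝ)..1, (leg k).eval x * (leg n).eval x =
      if k = n then (2 / (2 * n + 1) : ℝ) else 0 := by
  rcases lt_trichotomy k n with h | rfl | h
  · rw [integral_leg_mul_leg_of_lt h, if_neg h.ne]
  · rw [integral_leg_mul_leg_self, if_pos rfl]
  · simp only [mul_comm ((leg k).eval _)]
    rw [integral_leg_mul_leg_of_lt h, if_neg h.ne']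

lemma intervalIntegrable_finsetSum {S : Finset ℕ} {g : ℕ → ℝ → ℝ}
    (h : ∀ n, IntervalIntegrable (g n) volume (-1) 1) :
    IntervalIntegrable (fun x => ∑ n ∈ S, g n x) volume (-1) 1 := by
  have hs : (fun x => ∑ n ∈ S, g n x) = ∑ n ∈ S, g n := by
    ext x
    simp
  rw [hs]
  exact IntervalIntegrable.sum S fun n _ => h n

lemma integral_weighted_mul_leg (n m : ℕ) (F : ℕ → ℝ → ℝ)
    (hF : ∀ k < m, ∀ x ∈ Icc (-1 : ℝ) 1, HasDerivAt (F k) (F (k + 1) x) x)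
    (hc : ContinuousOn (F m) (Icc (-1) 1)) :
    ∫ x in (-1 : ℝ)..1, F m x * (derivative^[m] (leg n)).eval x * (1 - x ^ 2) ^ m =
      eigen n m * ∫ x in (-1 : ℝ)..1, F 0 x * (leg n).eval x := by
  have h := integral_iterate_by_parts m (quad ^ m * derivative^[m] (leg n))
    (fun j hj x hx => eval_iterate_derivative_quad_pow_mul _ hj hx) F hF hc
  have e : ∀ x : ℝ, F m x * (derivative^[m] (leg n)).eval x * (1 - x ^ 2) ^ m =
      (-1) ^ m * (F m x * (quad ^ m * derivative^[m] (leg n)).eval x) := fun x => by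
    rw [← neg_sub, neg_pow]
    simp [quad]
    ring
  simp only [e]
  rw [intervalIntegral.integral_const_mul, h, iterate_derivative_leg, ← mul_assoc, ← mul_pow]
  simp only [eval_mul, eval_C, mul_left_comm _ (eigen n m)]
  simp

lemma integral_weighted_leg_mul_leg (k n m : ℕ) :
    ∫ x in (-1 : ℝ)..1,
        (derivative^[m] (leg k)).eval x * (derivative^[m] (leg n)).eval x * (1 - x ^ 2) ^ m =
      if k = n then eigen n m * (2 / (2 * n + 1) : ℝ) else 0 := by
  rw [integral_weighted_mul_leg n m (fun j x => (derivative^[j] (leg k)).eval x) _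
    (derivative^[m] (leg k)).continuous.continuousOn]
  · simp [integral_leg_mul_leg]
  · intro j _ x _
    simp only [Function.iterate_succ_apply']
    exact (derivative^[j] (leg k)).hasDerivAt x

/-- Expansion of a weighted squared distance to a linear combination of an orthogonal family. -/
lemma integral_sq_sub_sum {S : Finset ℕ} {f w : ℝ → ℝ} {φ : ℕ → ℝ → ℝ} {ν a : ℕ → ℝ} (b : ℕ → ℝ)
    (hff : IntervalIntegrable (fun x => f x ^ 2 * w x) volume (-1) 1)
    (hfφ : ∀ n, IntervalIntegrable (fun x => f x * φ n x * w x) volume (-1) 1)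
    (hφφ : ∀ k n, IntervalIntegrable (fun x => φ k x * φ n x * w x) volume (-1) 1)
    (ha : ∀ n, ∫ x in (-1 : ℝ)..1, f x * φ n x * w x = a n)
    (hν : ∀ k n, ∫ x in (-1 : ℝ)..1, φ k x * φ n x * w x = if k = n then ν n else 0) :
    ∫ x in (-1 : ℝ)..1, (f x - ∑ n ∈ S, b n * φ n x) ^ 2 * w x =
      (∫ x in (-1 : ℝ)..1, f x ^ 2 * w x) - 2 * (∑ n ∈ S, b n * a n) + ∑ n ∈ S, b n ^ 2 * ν n := by
  have e : ∀ x, (f x - ∑ n ∈ S, b n * φ n x) ^ 2 * w x =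
      f x ^ 2 * w x - 2 * (∑ n ∈ S, b n * (f x * φ n x * w x)) +
        ∑ k ∈ S, ∑ n ∈ S, b k * b n * (φ k x * φ n x * w x) := fun x => by
    have h1 : ∑ n ∈ S, b n * (f x * φ n x * w x) = f x * w x * ∑ n ∈ S, b n * φ n x := by
      rw [Finset.mul_sum]
      exact Finset.sum_congr rfl fun n _ => by ring
    have h2 : ∑ k ∈ S, ∑ n ∈ S, b k * b n * (φ k x * φ n x * w x) =
        w x * ((∑ n ∈ S, b n * φ n x) * ∑ n ∈ S, b n * φ n x) := by
      rw [Finset.sum_mul_sum, Finset.mul_sum]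
      refine Finset.sum_congr rfl fun k _ => ?_
      rw [Finset.mul_sum]
      exact Finset.sum_congr rfl fun n _ => by ring
    rw [h1, h2]
    ring
  have i1 : IntervalIntegrable (fun x => ∑ n ∈ S, b n * (f x * φ n x * w x)) volume (-1) 1 :=
    intervalIntegrable_finsetSum fun n => (hfφ n).const_mul _
  have i2 : ∀ k, IntervalIntegrable
      (fun x => ∑ n ∈ S, b k * b n * (φ k x * φ n x * w x)) volume (-1) 1 := fun k =>
    intervalIntegrable_finsetSum fun n => (hφφ k n).const_mul _
  have i3 : IntervalIntegrable
      (fun x => ∑ k ∈ S, ∑ n ∈ S, b k * b n * (φ k x * φ n x * w x)) volume (-1) 1 :=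
    intervalIntegrable_finsetSum i2
  simp only [e]
  rw [intervalIntegral.integral_add (hff.sub (i1.const_mul 2)) i3,
    intervalIntegral.integral_sub hff (i1.const_mul 2), intervalIntegral.integral_const_mul,
    intervalIntegral.integral_finsetSum fun n _ => (hfφ n).const_mul _,
    intervalIntegral.integral_finsetSum fun k _ => i2 k]
  congr 1
  · simp [ha]
  · refine Finset.sum_congr rfl fun k hk => ?_
    rw [intervalIntegral.integral_finsetSum fun n _ => (hφφ k n).const_mul _]
    simp [hν, hk, sq]

lemma weighted_bessel (S : Finset ℕ) (m : ℕ) (F : ℕ → ℝ → ℝ)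
    (hF : ∀ k < m, ∀ x ∈ Icc (-1 : ℝ) 1, HasDerivAt (F k) (F (k + 1) x) x)
    (hc : ContinuousOn (F m) (Icc (-1) 1)) :
    ∑ n ∈ S, eigen n m * ((2 * n + 1) / 2) * (∫ x in (-1 : ℝ)..1, F 0 x * (leg n).eval x) ^ 2 ≤
      ∫ x in (-1 : ℝ)..1, F m x ^ 2 * (1 - x ^ 2) ^ m := by
  set a : ℕ → ℝ := fun n => ∫ x in (-1 : ℝ)..1, F 0 x * (leg n).eval x with ha
  have hI : uIcc (-1 : ℝ) 1 = Icc (-1) 1 := uIcc_of_le (by norm_num)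
  have hc' : ContinuousOn (F m) (uIcc (-1) 1) := hI ▸ hc
  have key := integral_sq_sub_sum (S := S) (f := F m) (w := fun x => (1 - x ^ 2) ^ m)
    (φ := fun n x => (derivative^[m] (leg n)).eval x) (fun n => (2 * n + 1) / 2 * a n)
    (ContinuousOn.intervalIntegrable (by fun_prop))
    (fun n => ContinuousOn.intervalIntegrable (by fun_prop))
    (fun k n => Continuous.intervalIntegrable (by fun_prop) _ _)
    (fun n => integral_weighted_mul_leg n m F hF hc)
    (fun k n => integral_weighted_leg_mul_leg k n m)
  have hnn : 0 ≤ ∫ x in (-1 : ℝ)..1,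
      (F m x - ∑ n ∈ S, (2 * n + 1) / 2 * a n * (derivative^[m] (leg n)).eval x) ^ 2 *
        (1 - x ^ 2) ^ m := by
    refine intervalIntegral.integral_nonneg (by norm_num) fun x hx => ?_
    have : 0 ≤ 1 - x ^ 2 := by nlinarith [hx.1, hx.2]
    positivity
  rw [key] at hnn
  have e1 : ∑ n ∈ S, (2 * (n : ℝ) + 1) / 2 * a n * (eigen n m * a n) =
      ∑ n ∈ S, eigen n m * ((2 * n + 1) / 2) * a n ^ 2 :=
    Finset.sum_congr rfl fun n _ => by ring
  have e2 : ∑ n ∈ S, ((2 * (n : ℝ) + 1) / 2 * a n) ^ 2 * (eigen n m * (2 / (2 * n + 1))) =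
      ∑ n ∈ S, eigen n m * ((2 * n + 1) / 2) * a n ^ 2 :=
    Finset.sum_congr rfl fun n _ => by
      have : 2 * (n : ℝ) + 1 ≠ 0 := by positivity
      field_simp
  linarith

/-- Squared distance in `L²(-1,1)` to a linear combination of Legendre polynomials. -/
lemma integral_sq_sub_sum_leg {f : ℝ → ℝ} (hf : IntervalIntegrable f volume (-1) 1)
    (hf2 : IntervalIntegrable (fun x => f x ^ 2) volume (-1) 1) (S : Finset ℕ) (b : ℕ → ℝ) :
    ∫ x in (-1 : ℝ)..1, (f x - ∑ n ∈ S, b n * (leg n).eval x) ^ 2 =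
      (∫ x in (-1 : ℝ)..1, f x ^ 2)
        - ∑ n ∈ S, (2 * n + 1) / 2 * (∫ x in (-1 : ℝ)..1, f x * (leg n).eval x) ^ 2
        + ∑ n ∈ S, 2 / (2 * n + 1) * (b n - legCoeff f n) ^ 2 := by
  have key := integral_sq_sub_sum (S := S) (f := f) (w := fun _ => 1)
    (φ := fun n x => (leg n).eval x) (ν := fun n => 2 / (2 * n + 1))
    (a := fun n => ∫ x in (-1 : ℝ)..1, f x * (leg n).eval x) b
    (by simpa using hf2)
    (fun n => by simpa using hf.mul_continuousOn (leg n).continuous.continuousOn)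
    (fun k n => Continuous.intervalIntegrable (by fun_prop) _ _)
    (fun n => by simp)
    (fun k n => by simpa using integral_leg_mul_leg k n)
  simp only [mul_one] at key
  rw [key, sub_add, sub_add, Finset.mul_sum, ← Finset.sum_sub_distrib, ← Finset.sum_sub_distrib]
  congr 1
  refine Finset.sum_congr rfl fun n _ => ?_
  simp only [legCoeff, legendre_eq_eval]
  have : 2 * (n : ℝ) + 1 ≠ 0 := by positivity
  field_simp
  ring

lemma legProj_eq (p : ℕ) (f : ℝ → ℝ) (x : ℝ) :
    legProj p f x = ∑ n ∈ Finset.range (p + 1), legCoeff f n * (leg n).eval x := by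
  simp only [legProj, legendre_eq_eval]

lemma integral_sq_sub_legProj {f : ℝ → ℝ} (hf : IntervalIntegrable f volume (-1) 1)
    (hf2 : IntervalIntegrable (fun x => f x ^ 2) volume (-1) 1) (p : ℕ) :
    ∫ x in (-1 : ℝ)..1, (f x - legProj p f x) ^ 2 =
      (∫ x in (-1 : ℝ)..1, f x ^ 2) - ∑ n ∈ Finset.range (p + 1),
        (2 * n + 1) / 2 * (∫ x in (-1 : ℝ)..1, f x * (leg n).eval x) ^ 2 := by
  simp only [legProj_eq]
  rw [integral_sq_sub_sum_leg hf hf2]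
  simp

lemma exists_eq_sum_leg (g : ℝ[X]) (p : ℕ) :
    ∃ N ≥ p, ∃ b : ℕ → ℝ, g = ∑ n ∈ Finset.range (N + 1), b n • leg n := by
  have hs := Sequence.span (S := ⟨leg, degree_leg⟩) fun i =>
    (leadingCoeff_ne_zero.2 (ne_zero_of_degree_gt (n := ⊥) (by
      change ⊥ < (leg i).degree
      rw [degree_leg]
      exact WithBot.bot_lt_coe _))).isUnit
  have hg : g ∈ Submodule.span ℝ (Set.range leg) := by
    change Submodule.span ℝ (Set.range leg) = ⊤ at hs
    rw [hs]
    trivial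
  obtain ⟨c, hc⟩ := Finsupp.mem_span_range_iff_exists_finsupp.1 hg
  refine ⟨max p (c.support.sup id), le_max_left _ _, c, ?_⟩
  rw [← hc]
  refine Finsupp.sum_of_support_subset _ (fun i hi => ?_) _ (by simp)
  have : i ≤ c.support.sup id := Finset.le_sup (f := id) hi
  rw [Finset.mem_range]
  omega

lemma exists_polynomial_integral_sq_sub_le {f : ℝ → ℝ} (hf : IntervalIntegrable f volume (-1) 1)
    (hf2 : IntervalIntegrable (fun x => f x ^ 2) volume (-1) 1) {ε : ℝ} (hε : 0 < ε) :
    ∃ g : ℝ[X], ∫ x in (-1 : ℝ)..1, (f x - g.eval x) ^ 2 ≤ ε := by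
  have hle : (-1 : ℝ) ≤ 1 := by norm_num
  have hm : MemLp f (ENNReal.ofReal 2) (volume.restrict (Ioc (-1) 1)) := by
    rw [ENNReal.ofReal_ofNat, memLp_two_iff_integrable_sq hf.1.aestronglyMeasurable]
    exact hf2.1
  obtain ⟨h, hh, -⟩ := hm.exists_boundedContinuous_integral_rpow_sub_le (by norm_num)
    (show 0 < ε / 4 by positivity)
  simp only [Real.rpow_ofNat, Real.norm_eq_abs, sq_abs] at hh
  rw [← intervalIntegral.integral_of_le hle] at hh
  obtain ⟨g, hg⟩ := exists_polynomial_near_of_continuousOn (-1) 1 h h.continuous.continuousOn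
    (Real.sqrt (ε / 8)) (by positivity)
  have hsub (u : ℝ → ℝ) (hu : Continuous u) :
      IntervalIntegrable (fun x => (f x - u x) ^ 2) volume (-1) 1 := by
    have e : (fun x => (f x - u x) ^ 2) = fun x => f x ^ 2 - 2 * (f x * u x) + u x ^ 2 := by
      ext x
      ring
    rw [e]
    exact (hf2.sub ((hf.mul_continuousOn hu.continuousOn).const_mul 2)).add
      ((hu.pow 2).intervalIntegrable _ _)
  refine ⟨g, ?_⟩
  calc ∫ x in (-1 : ℝ)..1, (f x - g.eval x) ^ 2
      ≤ ∫ x in (-1 : ℝ)..1, (2 * (f x - h x) ^ 2 + ε / 4) := by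
        refine intervalIntegral.integral_mono_on hle (hsub _ g.continuous)
          (((hsub _ h.continuous).const_mul 2).add intervalIntegrable_const) fun x hx => ?_
        have h1 : (g.eval x - h x) ^ 2 ≤ ε / 8 := by
          rw [← Real.sq_sqrt (show 0 ≤ ε / 8 by positivity)]
          exact sq_le_sq' (abs_lt.1 (hg x hx)).1.le (abs_lt.1 (hg x hx)).2.le
        nlinarith [sq_nonneg ((f x - h x) + (g.eval x - h x))]
    _ = 2 * (∫ x in (-1 : ℝ)..1, (f x - h x) ^ 2) + ε / 2 := by
        rw [intervalIntegral.integral_add ((hsub _ h.continuous).const_mul 2)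
          intervalIntegrable_const, intervalIntegral.integral_const_mul,
          intervalIntegral.integral_const]
        norm_num
        ring
    _ ≤ ε := by linarith

lemma exists_integral_sq_sub_legProj_le {f : ℝ → ℝ} (hf : IntervalIntegrable f volume (-1) 1)
    (hf2 : IntervalIntegrable (fun x => f x ^ 2) volume (-1) 1) (p : ℕ) {ε : ℝ} (hε : 0 < ε) :
    ∃ N ≥ p, ∫ x in (-1 : ℝ)..1, (f x - legProj N f x) ^ 2 ≤ ε := by
  obtain ⟨g, hg⟩ := exists_polynomial_integral_sq_sub_le hf hf2 hε
  obtain ⟨N, hN, b, rfl⟩ := exists_eq_sum_leg g p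
  refine ⟨N, hN, le_trans ?_ hg⟩
  simp only [eval_finsetSum, eval_smul, smul_eq_mul]
  rw [integral_sq_sub_legProj hf hf2, integral_sq_sub_sum_leg hf hf2]
  exact le_add_of_nonneg_right (Finset.sum_nonneg fun n _ => by positivity)

lemma eigen_mul_factorial {n m : ℕ} (h : m ≤ n) :
    eigen n m * ((n - m).factorial : ℝ) = ((n + m).factorial : ℝ) := by
  induction m with
  | zero => simp [eigen]
  | succ m ih =>
    obtain ⟨d, rfl⟩ := Nat.exists_eq_add_of_le h
    have ih := ih (by omega)
    rw [show m + 1 + d - m = d + 1 by omega, Nat.factorial_succ] at ih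
    rw [show m + 1 + d - (m + 1) = d by omega, ← add_assoc, Nat.factorial_succ, eigen,
      Finset.prod_range_succ, ← eigen]
    push_cast at ih ⊢
    rw [← ih]
    ring

lemma eigen_mono {n k m : ℕ} (h : m ≤ n) (hnk : n ≤ k) : eigen n m ≤ eigen k m := by
  have hnk' : (n : ℝ) ≤ k := by exact_mod_cast hnk
  have hpos : ∀ i ∈ Finset.range m, 0 ≤ (n : ℝ) - i := fun i hi => by
    have : (i : ℝ) ≤ n := by exact_mod_cast ((Finset.mem_range.1 hi).le.trans h)
    linarith
  refine Finset.prod_le_prod (fun i hi => mul_nonneg (hpos i hi) (by positivity)) fun i hi => ?_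
  have := hpos i hi
  gcongr
  linarith

lemma tendsto_integral_dilation {f : ℝ → ℝ} (hf : IntervalIntegrable f volume (-1) 1) (L : ℝ[X]) :
    Filter.Tendsto (fun r : ℝ => ∫ x in (-1 : ℝ)..1, f (r * x) * L.eval x) (nhdsWithin 1 (Iio 1))
      (nhds (∫ x in (-1 : ℝ)..1, f x * L.eval x)) := by
  have hle : (-1 : ℝ) ≤ 1 := by norm_num
  obtain ⟨M, hM⟩ := (isCompact_Icc (a := (-1 : ℝ)) (b := 1)).exists_bound_of_continuousOn
    L.continuous.continuousOn
  have hr : ∀ᶠ r : ℝ in nhdsWithin 1 (Iio 1), r ∈ Ioo (0 : ℝ) 1 :=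
    Ioo_mem_nhdsLT (by norm_num)
  have h1 : Filter.Tendsto (fun r : ℝ => r) (nhdsWithin 1 (Iio 1)) (nhds 1) :=
    Filter.tendsto_id.mono_left nhdsWithin_le_nhds
  have e : (fun r : ℝ => r⁻¹ * ∫ y in Ioc (-1 : ℝ) 1,
      (Ioc (-r) r).indicator (fun y => f y * L.eval (y / r)) y) =ᶠ[nhdsWithin 1 (Iio 1)]
      fun r => ∫ x in (-1 : ℝ)..1, f (r * x) * L.eval x := by
    filter_upwards [hr] with r hr
    have hs := intervalIntegral.integral_comp_mul_left (a := -1) (b := 1)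
      (fun y => f y * L.eval (y / r)) hr.1.ne'
    simp only [mul_div_cancel_left₀ _ hr.1.ne', mul_neg, mul_one, smul_eq_mul] at hs
    rw [hs, setIntegral_indicator measurableSet_Ioc,
      inter_eq_self_of_subset_right (Ioc_subset_Ioc (by linarith [hr.2]) hr.2.le),
      intervalIntegral.integral_of_le (by linarith [hr.1])]
  refine Filter.Tendsto.congr' e ?_
  rw [intervalIntegral.integral_of_le hle, ← one_mul (∫ x in Ioc (-1 : ℝ) 1, _)]
  refine Filter.Tendsto.mul (by simpa using h1.inv₀ one_ne_zero) ?_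
  refine tendsto_integral_filter_of_dominated_convergence (fun y => |f y| * M) ?_ ?_
    (hf.1.abs.mul_const M) ?_
  · filter_upwards with r
    exact (hf.1.aestronglyMeasurable.mul
      (Continuous.aestronglyMeasurable (by fun_prop))).indicator measurableSet_Ioc
  · filter_upwards [hr] with r hr
    filter_upwards with y
    have hM0 : 0 ≤ M := (norm_nonneg _).trans (hM 0 (by norm_num))
    by_cases hy : y ∈ Ioc (-r) r
    · rw [indicator_of_mem hy, norm_mul, Real.norm_eq_abs (f y)]
      gcongr
      refine hM _ ⟨?_, ?_⟩
      · rw [le_div_iff₀ hr.1]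
        linarith [hy.1]
      · rw [div_le_iff₀ hr.1]
        linarith [hy.2]
    · rw [indicator_of_notMem hy, norm_zero]
      positivity
  · have hae : ∀ᵐ y : ℝ ∂volume.restrict (Ioc (-1) 1), y ≠ 1 :=
      ae_restrict_of_ae (Measure.ae_ne volume 1)
    filter_upwards [hae, ae_restrict_mem measurableSet_Ioc] with y hy1 hy
    have hlt : |y| < 1 := abs_lt.2 ⟨hy.1, lt_of_le_of_ne hy.2 hy1⟩
    have hev : (fun r : ℝ => f y * L.eval (y / r)) =ᶠ[nhdsWithin 1 (Iio 1)]
        fun r => (Ioc (-r) r).indicator (fun y => f y * L.eval (y / r)) y := by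
      filter_upwards [h1.eventually (lt_mem_nhds hlt)] with r hr
      have hyr : y ∈ Ioc (-r) r := ⟨(abs_lt.1 hr).1, (abs_lt.1 hr).2.le⟩
      rw [indicator_of_mem hyr]
    refine Filter.Tendsto.congr' hev (Filter.Tendsto.const_mul _ ?_)
    have : Filter.Tendsto (fun r : ℝ => y / r) (nhdsWithin 1 (Iio 1)) (nhds y) := by
      have := Filter.Tendsto.div (tendsto_const_nhds (x := y)) h1 one_ne_zero
      rwa [div_one] at this
    exact (L.continuous.tendsto y).comp this

/-- Integrals against the weight `(1 - x²)^m` do not increase under dilation. -/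
lemma integral_dilation_sq_le {m : ℕ} (hm : 1 ≤ m) {h : ℝ → ℝ}
    (hh : ContinuousOn h (Ioo (-1) 1))
    (hi : IntegrableOn (fun x => h x ^ 2 * (1 - x ^ 2) ^ m) (Ioo (-1) 1)) {r : ℝ}
    (hr : r ∈ Ioo (0 : ℝ) 1) :
    ∫ x in (-1 : ℝ)..1, (r ^ m * h (r * x)) ^ 2 * (1 - x ^ 2) ^ m ≤
      ∫ x in (-1 : ℝ)..1, h x ^ 2 * (1 - x ^ 2) ^ m := by
  have hr0 := hr.1
  have hle : (-r) ≤ r := by linarith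
  have hsub : Icc (-r) r ⊆ Ioo (-1 : ℝ) 1 := Icc_subset_Ioo (by linarith [hr.2]) hr.2
  have hcr : ContinuousOn h (uIcc (-r) r) := by
    rw [uIcc_of_le hle]
    exact hh.mono hsub
  have hs := intervalIntegral.integral_comp_mul_left (a := -1) (b := 1)
    (fun y => h y ^ 2 * (1 - (y / r) ^ 2) ^ m) hr0.ne'
  simp only [mul_div_cancel_left₀ _ hr0.ne', mul_neg, mul_one, smul_eq_mul] at hs
  have hnn : 0 ≤ ∫ x in (-1 : ℝ)..1, h x ^ 2 * (1 - x ^ 2) ^ m := by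
    refine intervalIntegral.integral_nonneg (by norm_num) fun x hx => ?_
    have : 0 ≤ 1 - x ^ 2 := by nlinarith [hx.1, hx.2]
    positivity
  have hint : IntervalIntegrable (fun x => h x ^ 2 * (1 - x ^ 2) ^ m) volume (-1) 1 :=
    (intervalIntegrable_iff_integrableOn_Ioo_of_le (by norm_num)).2 hi
  have hmono : ∫ y in (-r)..r, h y ^ 2 * (1 - (y / r) ^ 2) ^ m ≤
      ∫ x in (-1 : ℝ)..1, h x ^ 2 * (1 - x ^ 2) ^ m := by
    calc ∫ y in (-r)..r, h y ^ 2 * (1 - (y / r) ^ 2) ^ m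
        ≤ ∫ y in (-r)..r, h y ^ 2 * (1 - y ^ 2) ^ m := by
          refine intervalIntegral.integral_mono_on hle
            (ContinuousOn.intervalIntegrable (by fun_prop))
            (ContinuousOn.intervalIntegrable (by fun_prop)) fun y hy => ?_
          have hy2 : y ^ 2 ≤ r ^ 2 := sq_le_sq' hy.1 hy.2
          have h1 : 0 ≤ 1 - (y / r) ^ 2 := by
            rw [div_pow, sub_nonneg, div_le_one (by positivity)]
            exact hy2
          have h2 : y ^ 2 ≤ (y / r) ^ 2 := by
            rw [div_pow]
            exact le_div_self (sq_nonneg _) (by positivity) (by nlinarith [hr.2])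
          gcongr
      _ ≤ ∫ x in (-1 : ℝ)..1, h x ^ 2 * (1 - x ^ 2) ^ m := by
          refine intervalIntegral.integral_mono_interval (by linarith [hr.2]) hle hr.2.le ?_ hint
          filter_upwards [ae_restrict_mem measurableSet_Ioc] with x hx
          have : 0 ≤ 1 - x ^ 2 := by nlinarith [hx.1, hx.2]
          simp only [Pi.zero_apply]
          positivity
  have e : ∀ x : ℝ, (r ^ m * h (r * x)) ^ 2 * (1 - x ^ 2) ^ m =
      (r ^ m) ^ 2 * (h (r * x) ^ 2 * (1 - x ^ 2) ^ m) := fun x => by ring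
  simp only [e]
  rw [intervalIntegral.integral_const_mul, hs, ← mul_assoc]
  have hc1 : (r ^ m) ^ 2 * r⁻¹ ≤ 1 := by
    obtain ⟨k, rfl⟩ := Nat.exists_eq_add_of_le hm
    have : (r ^ (1 + k)) ^ 2 * r⁻¹ = r ^ (2 * k + 1) := by
      field_simp
      ring
    rw [this]
    exact pow_le_one₀ hr0.le hr.2.le
  calc (r ^ m) ^ 2 * r⁻¹ * ∫ y in (-r)..r, h y ^ 2 * (1 - (y / r) ^ 2) ^ m
      ≤ (r ^ m) ^ 2 * r⁻¹ * ∫ x in (-1 : ℝ)..1, h x ^ 2 * (1 - x ^ 2) ^ m :=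
        mul_le_mul_of_nonneg_left hmono (by positivity)
    _ ≤ ∫ x in (-1 : ℝ)..1, h x ^ 2 * (1 - x ^ 2) ^ m := mul_le_of_le_one_left hnn hc1

lemma hasDerivAt_dilation {m : ℕ} {ω : ℝ → ℝ} (hω : ContDiffOn ℝ (m : ℕ∞) ω (Ioo (-1 : ℝ) 1))
    {r : ℝ} (hr : r ∈ Ioo (0 : ℝ) 1) {k : ℕ} (hk : k < m) {x : ℝ} (hx : x ∈ Icc (-1 : ℝ) 1) :
    HasDerivAt (fun x => r ^ k * iteratedDerivWithin k ω (Ioo (-1) 1) (r * x))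
      (r ^ (k + 1) * iteratedDerivWithin (k + 1) ω (Ioo (-1) 1) (r * x)) x := by
  have hrx : r * x ∈ Ioo (-1 : ℝ) 1 :=
    ⟨by nlinarith [hr.1, hr.2, hx.1, hx.2], by nlinarith [hr.1, hr.2, hx.1, hx.2]⟩
  have hd := (hω.differentiableOn_iteratedDerivWithin (m := k) (by exact_mod_cast hk)
    (uniqueDiffOn_Ioo _ _) _ hrx).hasDerivWithinAt.hasDerivAt (Ioo_mem_nhds hrx.1 hrx.2)
  rw [← iteratedDerivWithin_succ] at hd
  refine ((hd.comp x ((hasDerivAt_id x).const_mul r)).const_mul (r ^ k)).congr_deriv ?_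
  ring

lemma weighted_bessel_Ioo {m : ℕ} (hm : 1 ≤ m) {ω : ℝ → ℝ}
    (hω1 : IntervalIntegrable ω volume (-1) 1)
    (hω : ContDiffOn ℝ (m : ℕ∞) ω (Ioo (-1 : ℝ) 1))
    (hi : IntegrableOn
      (fun ξ => (iteratedDerivWithin m ω (Ioo (-1 : ℝ) 1) ξ) ^ 2 * (1 - ξ ^ 2) ^ m)
      (Ioo (-1 : ℝ) 1) volume) (S : Finset ℕ) :
    ∑ n ∈ S, eigen n m * ((2 * n + 1) / 2) * (∫ x in (-1 : ℝ)..1, ω x * (leg n).eval x) ^ 2 ≤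
      ∫ ξ in (-1 : ℝ)..1, (iteratedDerivWithin m ω (Ioo (-1 : ℝ) 1) ξ) ^ 2 * (1 - ξ ^ 2) ^ m := by
  have hcont : ContinuousOn (iteratedDerivWithin m ω (Ioo (-1 : ℝ) 1)) (Ioo (-1) 1) :=
    hω.continuousOn_iteratedDerivWithin le_rfl (uniqueDiffOn_Ioo _ _)
  refine le_of_tendsto (x := nhdsWithin (1 : ℝ) (Iio 1))
    (tendsto_finsetSum S fun n _ => ((tendsto_integral_dilation hω1 (leg n)).pow 2).const_mul _) ?_
  filter_upwards [Ioo_mem_nhdsLT (show (0 : ℝ) < 1 by norm_num)] with r hr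
  have hmaps : MapsTo (fun x => r * x) (Icc (-1 : ℝ) 1) (Ioo (-1) 1) := fun x hx =>
    ⟨by nlinarith [hr.1, hr.2, hx.1, hx.2], by nlinarith [hr.1, hr.2, hx.1, hx.2]⟩
  have hb := weighted_bessel S m
    (fun k x => r ^ k * iteratedDerivWithin k ω (Ioo (-1) 1) (r * x))
    (fun k hk x hx => hasDerivAt_dilation hω hr hk hx)
    (continuousOn_const.mul (hcont.comp (by fun_prop) hmaps))
  simp only [pow_zero, one_mul, iteratedDerivWithin_zero] at hb
  exact hb.trans (integral_dilation_sq_le hm hcont hi hr)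

theorem integral_sq_sub_legProj_le {m : ℕ} (hm : 1 ≤ m) {ω : ℝ → ℝ}
    (hω1 : IntervalIntegrable ω volume (-1) 1)
    (hω2 : IntervalIntegrable (fun x => ω x ^ 2) volume (-1) 1)
    (hω : ContDiffOn ℝ (m : ℕ∞) ω (Ioo (-1 : ℝ) 1))
    (hi : IntegrableOn
      (fun ξ => (iteratedDerivWithin m ω (Ioo (-1 : ℝ) 1) ξ) ^ 2 * (1 - ξ ^ 2) ^ m)
      (Ioo (-1 : ℝ) 1) volume) {p : ℕ} (hp : m ≤ p) :
    (∫ x in (-1 : ℝ)..1, (ω x - legProj p ω x) ^ 2) ≤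
      ((Nat.factorial (p - m + 1) : ℝ) / (Nat.factorial (p + m + 1) : ℝ)) *
        ∫ ξ in (-1 : ℝ)..1,
          (iteratedDerivWithin m ω (Ioo (-1 : ℝ) 1) ξ) ^ 2 * (1 - ξ ^ 2) ^ m := by
  refine le_of_forall_pos_le_add fun ε hε => ?_
  obtain ⟨N, hN, hNε⟩ := exists_integral_sq_sub_legProj_le hω1 hω2 p hε
  have hb := weighted_bessel_Ioo hm hω1 hω hi (Finset.Ico (p + 1) (N + 1))
  set J := ∫ ξ in (-1 : ℝ)..1,
    (iteratedDerivWithin m ω (Ioo (-1 : ℝ) 1) ξ) ^ 2 * (1 - ξ ^ 2) ^ m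
  rw [integral_sq_sub_legProj hω1 hω2,
    ← Finset.sum_range_add_sum_Ico _ (Nat.succ_le_succ hN)] at hNε
  rw [integral_sq_sub_legProj hω1 hω2]
  have hfac := eigen_mul_factorial (n := p + 1) (m := m) (by omega)
  rw [show p + 1 - m = p - m + 1 by omega, show p + 1 + m = p + m + 1 by omega] at hfac
  have hle : eigen (p + 1) m * ∑ n ∈ Finset.Ico (p + 1) (N + 1),
      (2 * (n : ℝ) + 1) / 2 * (∫ x in (-1 : ℝ)..1, ω x * (leg n).eval x) ^ 2 ≤ J := by
    refine le_trans ?_ hb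
    rw [Finset.mul_sum]
    refine Finset.sum_le_sum fun n hn => ?_
    rw [← mul_assoc]
    have := eigen_mono (m := m) (by omega) (Finset.mem_Ico.1 hn).1
    gcongr
  have hf1 : (0 : ℝ) < (p - m + 1).factorial := by positivity
  have hf2 : (0 : ℝ) < (p + m + 1).factorial := by positivity
  have htail : ∑ n ∈ Finset.Ico (p + 1) (N + 1),
      (2 * (n : ℝ) + 1) / 2 * (∫ x in (-1 : ℝ)..1, ω x * (leg n).eval x) ^ 2 ≤
      ((p - m + 1).factorial : ℝ) / ((p + m + 1).factorial : ℝ) * J := by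
    rw [div_mul_eq_mul_div, le_div_iff₀ hf2, ← hfac]
    nlinarith [mul_le_mul_of_nonneg_left hle hf1.le]
  simp only [Nat.succ_eq_add_one] at hNε
  linarith

lemma factorial_div_factorial_le {m p : ℕ} (hm : 1 ≤ m) (hp : m ≤ p) :
    ((p - m + 1).factorial : ℝ) / ((p + m + 1).factorial : ℝ) ≤
      ((m : ℝ) ^ m * ((p : ℝ) ^ m)⁻¹) ^ 2 := by
  have h1 : (p - m + 1).factorial * (p - m + 1 + 1) ^ (2 * m) ≤ (p + m + 1).factorial := by
    have := Nat.factorial_mul_pow_le_factorial (m := p - m + 1) (n := 2 * m)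
    rwa [show p - m + 1 + 2 * m = p + m + 1 by omega] at this
  have h2 : p ≤ m * (p - m + 1 + 1) := by
    obtain ⟨d, rfl⟩ := Nat.exists_eq_add_of_le hp
    rw [show m + d - m = d by omega]
    nlinarith
  have h3 : (p - m + 1).factorial * p ^ (2 * m) ≤ m ^ (2 * m) * (p + m + 1).factorial :=
    calc (p - m + 1).factorial * p ^ (2 * m)
        ≤ (p - m + 1).factorial * (m * (p - m + 1 + 1)) ^ (2 * m) := by gcongr
      _ = m ^ (2 * m) * ((p - m + 1).factorial * (p - m + 1 + 1) ^ (2 * m)) := by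
        rw [mul_pow, mul_left_comm]
      _ ≤ m ^ (2 * m) * (p + m + 1).factorial := by gcongr
  have hp0 : (0 : ℝ) < p := by exact_mod_cast (by omega : 0 < p)
  have e : ((m : ℝ) ^ m * ((p : ℝ) ^ m)⁻¹) ^ 2 = (m : ℝ) ^ (2 * m) / (p : ℝ) ^ (2 * m) := by
    rw [mul_pow, inv_pow, ← pow_mul, ← pow_mul, mul_comm m 2, div_eq_mul_inv]
  rw [e, div_le_div_iff₀ (by positivity) (by positivity)]
  exact_mod_cast h3

end LegendreExpansion

/-- the weighted `L²`-projection estimate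
`‖ω − Π_p ω‖² ≤ ((p−m+1)!/(p+m+1)!) ∫ |ω^{(m)}|²(1−ξ²)^m dξ`, and the
consequent `O(p^{−m})` bound with a constant depending only on `m`. -/
theorem stmt_19 (m : ℕ) (hm : 1 ≤ m) :
    (∀ (ω : ℝ → ℝ),
      IntervalIntegrable ω volume (-1) 1 →
      IntervalIntegrable (fun x => ω x ^ 2) volume (-1) 1 →
      ContDiffOn ℝ (m : ℕ∞) ω (Set.Ioo (-1 : ℝ) 1) →
      IntegrableOn
        (fun ξ => (iteratedDerivWithin m ω (Set.Ioo (-1 : ℝ) 1) ξ) ^ 2 * (1 - ξ ^ 2) ^ m)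
        (Set.Ioo (-1 : ℝ) 1) volume →
      ∀ p : ℕ, m ≤ p →
        (∫ x in (-1 : ℝ)..1, (ω x - legProj p ω x) ^ 2) ≤
          ((Nat.factorial (p - m + 1) : ℝ) / (Nat.factorial (p + m + 1) : ℝ)) *
            ∫ ξ in (-1 : ℝ)..1,
              (iteratedDerivWithin m ω (Set.Ioo (-1 : ℝ) 1) ξ) ^ 2 * (1 - ξ ^ 2) ^ m) ∧
    (∃ C > (0 : ℝ), ∀ (ω : ℝ → ℝ),
      IntervalIntegrable ω volume (-1) 1 →
      IntervalIntegrable (fun x => ω x ^ 2) volume (-1) 1 →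
      ContDiffOn ℝ (m : ℕ∞) ω (Set.Ioo (-1 : ℝ) 1) →
      IntegrableOn
        (fun ξ => (iteratedDerivWithin m ω (Set.Ioo (-1 : ℝ) 1) ξ) ^ 2 * (1 - ξ ^ 2) ^ m)
        (Set.Ioo (-1 : ℝ) 1) volume →
      ∀ p : ℕ, m ≤ p →
        Real.sqrt (∫ x in (-1 : ℝ)..1, (ω x - legProj p ω x) ^ 2) ≤
          C * (p : ℝ) ^ (-(m : ℝ)) *
            Real.sqrt (∫ ξ in (-1 : ℝ)..1,
              (iteratedDerivWithin m ω (Set.Ioo (-1 : ℝ) 1) ξ) ^ 2 * (1 - ξ ^ 2) ^ m)) := by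
  have hm0 : (0 : ℝ) < m := by exact_mod_cast hm
  refine ⟨fun ω h1 h2 h3 h4 p hp =>
    LegendreExpansion.integral_sq_sub_legProj_le hm h1 h2 h3 h4 hp, (m : ℝ) ^ m, by positivity,
    fun ω h1 h2 h3 h4 p hp => ?_⟩
  have h := LegendreExpansion.integral_sq_sub_legProj_le hm h1 h2 h3 h4 hp
  have hnn : 0 ≤ ∫ ξ in (-1 : ℝ)..1,
      (iteratedDerivWithin m ω (Set.Ioo (-1 : ℝ) 1) ξ) ^ 2 * (1 - ξ ^ 2) ^ m := by
    refine intervalIntegral.integral_nonneg (by norm_num) fun x hx => ?_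
    have : 0 ≤ 1 - x ^ 2 := by nlinarith [hx.1, hx.2]
    positivity
  rw [Real.rpow_neg (Nat.cast_nonneg p), Real.rpow_natCast]
  refine Real.sqrt_le_iff.2 ⟨by positivity, h.trans ?_⟩
  rw [mul_pow _ (Real.sqrt _), Real.sq_sqrt hnn]
  exact mul_le_mul_of_nonneg_right (LegendreExpansion.factorial_div_factorial_le hm hp) hnn
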